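/- Let L_n^{d,alpha} be a line hypergraph with d = 2*alpha. Then all nonzero graded Betti numbers of R/I(L_n^{d,alpha}) occur in degrees that are multiples of alpha, and for 2j ≥ i: beta_{i, j*alpha}(R/I(L_n^{d,alpha})) = C(j-i, 2i-j) * C(n+1-2j+2i, j-i) + C(j-i-1, 2i-j) * C(n+1-2j+2i, j-i-1). -/

import Mathlib

open MvPolynomial

/-- A *minimal graded free resolution* of `R ⧸ I`, where `R = k[x_v : v ∈ V]` is the
polynomial ring with its standard grading.  The `i`-th free module is
`⨁_j R(-j)^{β i j}`, encoded as finitely supported functions on `Σ j, Fin (β i j)`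
(the basis element `⟨j, t⟩` having degree `j`).  The graded Betti number
`β_{i,j}(R ⧸ I) = dim_k Tor_i^R(R ⧸ I, k)_j` equals `β i j` for any such resolution. -/
structure MinimalGradedFreeResolution (k V : Type) [Field k] [Fintype V] [DecidableEq V]
    (I : Ideal (MvPolynomial V k)) where
  /-- the ranks: `β i j` copies of `R(-j)` in homological degree `i` -/
  β : ℕ → ℕ → ℕ
  /-- the `0`-th free module is a single copy of `R` generated in degree `0` -/
  β_zero : ∀ j, β 0 j = if j = 0 then 1 else 0
  /-- the differentials -/
  d : ∀ i : ℕ,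
    ((Σ j : ℕ, Fin (β (i + 1) j)) →₀ MvPolynomial V k) →ₗ[MvPolynomial V k]
      ((Σ j : ℕ, Fin (β i j)) →₀ MvPolynomial V k)
  /-- the augmentation onto `R ⧸ I` -/
  aug : ((Σ j : ℕ, Fin (β 0 j)) →₀ MvPolynomial V k) →ₗ[MvPolynomial V k]
      (MvPolynomial V k ⧸ I)
  aug_surjective : Function.Surjective aug
  /-- exactness at homological degree `0` -/
  exact_zero : LinearMap.ker aug = LinearMap.range (d 0)
  /-- exactness at homological degree `i + 1` -/
  exact_succ : ∀ i, LinearMap.ker (d i) = LinearMap.range (d (i + 1))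
  /-- minimality: the image of each differential lies in `m · F`, where `m = (x_v : v ∈ V)` -/
  minimal : ∀ i x p, constantCoeff ((d i x) p) = 0
  /-- the differentials are graded: the image of a degree-`j` basis vector is homogeneous
  of degree `j` -/
  graded : ∀ (i j : ℕ) (t : Fin (β (i + 1) j)) (p : Σ j' : ℕ, Fin (β i j')),
      ((d i (Finsupp.single ⟨j, t⟩ 1)) p).IsHomogeneous (j - p.1) ∧
        (p.1 ≤ j ∨ (d i (Finsupp.single ⟨j, t⟩ 1)) p = 0)

/-- The edge ideal `I(H)` of a hypergraph with edges `E 0, …, E (n-1)`: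
the ideal generated by the squarefree monomials `x^{E i} = ∏_{v ∈ E i} x_v`. -/
noncomputable def edgeIdeal (k : Type) {V : Type} [Field k] [Fintype V] [DecidableEq V]
    {n : ℕ} (E : Fin n → Finset V) : Ideal (MvPolynomial V k) :=
  Ideal.span (Set.range fun i => ∏ v ∈ E i, (X v : MvPolynomial V k))

/-- `E 0, …, E (n-1)` are the edges of a line hypergraph `L_n^{d,α}`, whose vertex set is
all of `V` (the union of the edges): each edge has `d` vertices, two distinct edges
intersect exactly when they are consecutive, and consecutive edges meet in `α` vertices. -/
structure IsLineHypergraph {V : Type} [DecidableEq V] (n d α : ℕ) (E : ℕ → Finset V) :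
    Prop where
  card_eq : ∀ i < n, (E i).card = d
  inter_nonempty_iff : ∀ i < n, ∀ j < n, i ≠ j →
    ((E i ∩ E j).Nonempty ↔ (j = i + 1 ∨ i = j + 1))
  inter_card : ∀ i, i + 1 < n → (E i ∩ E (i + 1)).card = α
  cover : ∀ v : V, ∃ i < n, v ∈ E i

/-- The binomial coefficient `C(a, b)` for integer arguments, with the usual convention
that it vanishes when `a < 0` or `b < 0` (or `b > a ≥ 0`). -/
def intChoose (a b : ℤ) : ℕ :=
  if 0 ≤ a ∧ 0 ≤ b then a.toNat.choose b.toNat else 0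

section Helpers

open Finsupp

variable {k V : Type} [Field k]

/-- Homogeneous element of degree `n` in a graded free module. -/
def Hg {B : Type} (deg : B → ℕ) (n : ℕ) (x : B →₀ MvPolynomial V k) : Prop :=
  ∀ p, (x p).IsHomogeneous (n - deg p) ∧ (deg p ≤ n ∨ x p = 0)

/-- Graded linear map between graded free modules. -/
def GrMap {B C : Type} (dB : B → ℕ) (dC : C → ℕ)
    (f : (B →₀ MvPolynomial V k) →ₗ[MvPolynomial V k] (C →₀ MvPolynomial V k)) : Prop :=
  ∀ b, Hg dC (dB b) (f (single b 1))

lemma map_apply_eq_sum {B C : Type}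
    (f : (B →₀ MvPolynomial V k) →ₗ[MvPolynomial V k] (C →₀ MvPolynomial V k))
    (x : B →₀ MvPolynomial V k) (c : C) :
    (f x) c = ∑ b ∈ x.support, x b * (f (single b 1)) c := by
  conv_lhs => rw [← Finsupp.sum_single x]
  rw [Finsupp.sum, map_sum, Finsupp.finsetSum_apply]
  refine Finset.sum_congr rfl fun b _ => ?_
  rw [← mul_one (x b), ← smul_eq_mul, ← Finsupp.smul_single, map_smul]
  simp

lemma Hg.map {B C : Type} {dB : B → ℕ} {dC : C → ℕ}
    {f : (B →₀ MvPolynomial V k) →ₗ[MvPolynomial V k] (C →₀ MvPolynomial V k)}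
    (hf : GrMap dB dC f) {n : ℕ} {x : B →₀ MvPolynomial V k} (hx : Hg dB n x) :
    Hg dC n (f x) := by
  intro c
  have key : ∀ b, (x b * (f (single b 1)) c).IsHomogeneous (n - dC c) ∧
      (dC c ≤ n ∨ x b * (f (single b 1)) c = 0) := by
    intro b
    obtain ⟨h1, h2⟩ := hx b
    obtain ⟨h3, h4⟩ := hf b c
    rcases h2 with h2 | h2
    · rcases h4 with h4 | h4
      · refine ⟨?_, Or.inl (h4.trans h2)⟩
        have := h1.mul h3
        have e : n - dB b + (dB b - dC c) = n - dC c := by omega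
        rwa [e] at this
      · rw [h4, mul_zero]; exact ⟨isHomogeneous_zero _ _ _, Or.inr rfl⟩
    · rw [h2, zero_mul]; exact ⟨isHomogeneous_zero _ _ _, Or.inr rfl⟩
  rw [map_apply_eq_sum]
  refine ⟨IsHomogeneous.sum _ _ _ fun b _ => (key b).1, ?_⟩
  by_cases h : dC c ≤ n
  · exact Or.inl h
  · exact Or.inr (Finset.sum_eq_zero fun b _ => (key b).2.resolve_left h)

/-- Component of degree `n` of an element of `R(-m)`. -/
noncomputable def hcomp (m n : ℕ) : MvPolynomial V k →ₗ[k] MvPolynomial V k :=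
  if m ≤ n then homogeneousComponent (n - m) else 0

lemma homogeneousComponent_mul_right {r D : MvPolynomial V k} {e : ℕ} (hD : D.IsHomogeneous e)
    (n : ℕ) : homogeneousComponent n (r * D) =
      if e ≤ n then homogeneousComponent (n - e) r * D else 0 := by
  let _ := MvPolynomial.gradedAlgebra (σ := V) (R := k)
  have key : ∀ (φ : MvPolynomial V k) i,
      (DirectSum.decompose (homogeneousSubmodule V k) φ i : MvPolynomial V k) =
        homogeneousComponent i φ := MvPolynomial.decomposition.decompose'_apply
  have := DirectSum.coe_decompose_mul_of_right_mem (homogeneousSubmodule V k) n (a := r) (b := D)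
    (i := e) hD
  rw [key, key] at this
  exact this

lemma hcomp_mul {b c : ℕ} {D : MvPolynomial V k} (h : D.IsHomogeneous (b - c))
    (h' : c ≤ b ∨ D = 0) (n : ℕ) (r : MvPolynomial V k) :
    hcomp c n (r * D) = hcomp b n r * D := by
  rcases h' with h' | h'
  · unfold hcomp
    by_cases h1 : c ≤ n
    · rw [if_pos h1, homogeneousComponent_mul_right h]
      by_cases h2 : b ≤ n
      · have e : n - c - (b - c) = n - b := by omega
        rw [if_pos h2, if_pos (by omega), e]
      · rw [if_neg h2, if_neg (by omega)]; simp
    · rw [if_neg h1, if_neg (by omega)]; simp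
  · subst h'; simp

lemma hcomp_of_Hg {B : Type} {deg : B → ℕ} {n : ℕ} {x : B →₀ MvPolynomial V k}
    (hx : Hg deg n x) (b : B) : hcomp (deg b) n (x b) = x b := by
  obtain ⟨h1, h2⟩ := hx b
  rcases h2 with h2 | h2
  · rw [hcomp, if_pos h2, homogeneousComponent_of_mem h1, if_pos rfl]
  · simp [h2]

lemma lift_Hg {B C : Type} {dB : B → ℕ} {dC : C → ℕ}
    {f : (B →₀ MvPolynomial V k) →ₗ[MvPolynomial V k] (C →₀ MvPolynomial V k)}
    (hf : GrMap dB dC f) {n : ℕ} {x : C →₀ MvPolynomial V k} (hx : Hg dC n x)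
    (hr : x ∈ LinearMap.range f) : ∃ y, Hg dB n y ∧ f y = x := by
  classical
  obtain ⟨y, rfl⟩ := hr
  let y' : B →₀ MvPolynomial V k :=
    Finsupp.onFinset y.support (fun b => hcomp (dB b) n (y b)) (by
      intro b hb
      rw [Finsupp.mem_support_iff]
      intro h0
      apply hb
      rw [h0, map_zero])
  refine ⟨y', ?_, ?_⟩
  · intro b
    change (hcomp (dB b) n (y b)).IsHomogeneous _ ∧ (_ ∨ hcomp (dB b) n (y b) = 0)
    unfold hcomp
    split_ifs with h
    · exact ⟨homogeneousComponent_isHomogeneous _ _, Or.inl h⟩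
    · exact ⟨isHomogeneous_zero _ _ _, Or.inr rfl⟩
  · ext1 c
    rw [← hcomp_of_Hg hx c, map_apply_eq_sum, map_apply_eq_sum f y, map_sum]
    have hs : y'.support ⊆ y.support := Finsupp.support_onFinset_subset
    rw [Finset.sum_subset hs (fun b _ hb => by
      rw [Finsupp.notMem_support_iff.mp hb, zero_mul])]
    refine Finset.sum_congr rfl fun b _ => ?_
    rw [hcomp_mul (hf b c).1 (hf b c).2]
    rfl

/-- Dependent choice. -/
lemma dep_choice {X : ℕ → Type} (P : ∀ i, X i → Prop) (r : ∀ i, X i → X (i + 1) → Prop)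
    (x0 : X 0) (h0 : P 0 x0) (step : ∀ i x, P i x → ∃ y, P (i + 1) y ∧ r i x y) :
    ∃ f : ∀ i, X i, f 0 = x0 ∧ (∀ i, P i (f i)) ∧ ∀ i, r i (f i) (f (i + 1)) := by
  choose g hg using step
  let F : ∀ i, {x : X i // P i x} := fun i =>
    Nat.rec (motive := fun i => {x : X i // P i x}) ⟨x0, h0⟩
      (fun i x => ⟨g i x.1 x.2, (hg i x.1 x.2).1⟩) i
  exact ⟨fun i => (F i).1, rfl, fun i => (F i).2, fun i => (hg i (F i).1 (F i).2).2⟩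

/-- Lifting of a graded map to a chain map. -/
lemma exists_chain {B C : ℕ → Type} {degB : ∀ i, B i → ℕ} {degC : ∀ i, C i → ℕ}
    {dB : ∀ i, (B (i + 1) →₀ MvPolynomial V k) →ₗ[MvPolynomial V k] (B i →₀ MvPolynomial V k)}
    {dC : ∀ i, (C (i + 1) →₀ MvPolynomial V k) →ₗ[MvPolynomial V k] (C i →₀ MvPolynomial V k)}
    (gB : ∀ i, GrMap (degB (i + 1)) (degB i) (dB i))
    (gC : ∀ i, GrMap (degC (i + 1)) (degC i) (dC i))
    (hB : ∀ i x, dB i (dB (i + 1) x) = 0)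
    (hC : ∀ i, LinearMap.ker (dC i) = LinearMap.range (dC (i + 1)))
    (f0 : (B 0 →₀ MvPolynomial V k) →ₗ[MvPolynomial V k] (C 0 →₀ MvPolynomial V k))
    (hf0 : GrMap (degB 0) (degC 0) f0)
    (hf0' : ∀ x, f0 (dB 0 x) ∈ LinearMap.range (dC 0)) :
    ∃ f : ∀ i, (B i →₀ MvPolynomial V k) →ₗ[MvPolynomial V k] (C i →₀ MvPolynomial V k),
      f 0 = f0 ∧ (∀ i, GrMap (degB i) (degC i) (f i)) ∧
        ∀ i x, dC i (f (i + 1) x) = f i (dB i x) := by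
  obtain ⟨f, h1, h2, h3⟩ := dep_choice
    (X := fun i => (B i →₀ MvPolynomial V k) →ₗ[MvPolynomial V k] (C i →₀ MvPolynomial V k))
    (fun i f => GrMap (degB i) (degC i) f ∧ ∀ x, f (dB i x) ∈ LinearMap.range (dC i))
    (fun i f f' => ∀ x, dC i (f' x) = f (dB i x)) f0 ⟨hf0, hf0'⟩ (by
      rintro i f ⟨hf, hf'⟩
      have : ∀ b : B (i + 1), ∃ y, Hg (degC (i + 1)) (degB (i + 1) b) y ∧
          dC i y = f (dB i (single b 1)) := fun b =>
        lift_Hg (gC i) (Hg.map hf (gB i b)) (hf' _)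
      choose y hy hy' using this
      have hcomm : ∀ x, dC i (Finsupp.linearCombination (MvPolynomial V k) y x) =
          f (dB i x) := by
        intro x
        have : dC i ∘ₗ Finsupp.linearCombination (MvPolynomial V k) y = f ∘ₗ dB i := by
          apply Finsupp.lhom_ext'
          intro b
          apply LinearMap.ext_ring
          simp [hy']
        exact LinearMap.congr_fun this x
      refine ⟨Finsupp.linearCombination (MvPolynomial V k) y, ⟨fun b => ?_, fun x => ?_⟩, hcomm⟩
      · simpa using hy b
      · rw [← hC, LinearMap.mem_ker, hcomm, hB, map_zero])
  exact ⟨f, h1, fun i => (h2 i).1, h3⟩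

/-- Minimal graded free resolutions with abstract bases. -/
structure GRes (I : Ideal (MvPolynomial V k)) where
  B : ℕ → Type
  deg : ∀ i, B i → ℕ
  d : ∀ i, (B (i + 1) →₀ MvPolynomial V k) →ₗ[MvPolynomial V k] (B i →₀ MvPolynomial V k)
  pt : B 0
  uniq : ∀ b, b = pt
  deg0 : ∀ b, deg 0 b = 0
  exact0 : ∀ x, x ∈ LinearMap.range (d 0) ↔ x pt ∈ I
  exact : ∀ i, LinearMap.ker (d i) = LinearMap.range (d (i + 1))
  minimal : ∀ i x p, constantCoeff ((d i x) p) = 0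
  graded : ∀ i, GrMap (deg (i + 1)) (deg i) (d i)

lemma GRes.dd {I : Ideal (MvPolynomial V k)} (F : GRes I) (i x) : F.d i (F.d (i + 1) x) = 0 := by
  rw [← LinearMap.mem_ker, F.exact]; exact ⟨x, rfl⟩

lemma cc_map {B C : Type}
    (f : (B →₀ MvPolynomial V k) →ₗ[MvPolynomial V k] (C →₀ MvPolynomial V k))
    (x : B →₀ MvPolynomial V k) (hx : ∀ b, constantCoeff (x b) = 0) (c : C) :
    constantCoeff (f x c) = 0 := by
  rw [map_apply_eq_sum, map_sum]
  exact Finset.sum_eq_zero fun b _ => by rw [map_mul, hx, zero_mul]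

/-- An endomorphism of a minimal resolution lifting the identity is the identity mod `m`. -/
lemma GRes.endo {I : Ideal (MvPolynomial V k)} (F : GRes I)
    (φ : ∀ i, (F.B i →₀ MvPolynomial V k) →ₗ[MvPolynomial V k] (F.B i →₀ MvPolynomial V k))
    (h0 : ∀ x, φ 0 x = x) (hφ : ∀ i x, F.d i (φ (i + 1) x) = φ i (F.d i x)) (i : ℕ) (x) (p) :
    constantCoeff ((φ i x - x) p) = 0 := by
  have main : ∀ i, ∃ h : (F.B i →₀ MvPolynomial V k) →ₗ[MvPolynomial V k]
      (F.B (i + 1) →₀ MvPolynomial V k),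
      ∀ x, F.d i (φ (i + 1) x - x - h (F.d i x)) = 0 := by
    intro i
    induction i with
    | zero =>
      refine ⟨0, fun x => ?_⟩
      simp [hφ, h0]
    | succ i ih =>
      obtain ⟨h, hh⟩ := ih
      have : ∀ b : F.B (i + 1), ∃ y, F.d (i + 1) y =
          φ (i + 1) (single b 1) - single b 1 - h (F.d i (single b 1)) := by
        intro b
        have := hh (single b 1)
        rw [← LinearMap.mem_ker, F.exact] at this
        exact this
      choose y hy using this
      have hcomm : ∀ x, F.d (i + 1) (Finsupp.linearCombination (MvPolynomial V k) y x) =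
          φ (i + 1) x - x - h (F.d i x) := by
        intro x
        have : F.d (i + 1) ∘ₗ Finsupp.linearCombination (MvPolynomial V k) y =
            φ (i + 1) - LinearMap.id - h ∘ₗ F.d i := by
          apply Finsupp.lhom_ext'
          intro b
          apply LinearMap.ext_ring
          simp [hy]
        exact LinearMap.congr_fun this x
      refine ⟨Finsupp.linearCombination (MvPolynomial V k) y, fun x => ?_⟩
      rw [map_sub, map_sub, hφ, hcomm, F.dd]
      simp
  cases i with
  | zero => simp [h0]
  | succ i =>
    obtain ⟨h, hh⟩ := main i
    have h1 := hh x
    rw [← LinearMap.mem_ker, F.exact] at h1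
    obtain ⟨y, hy⟩ := h1
    have : φ (i + 1) x - x = F.d (i + 1) y + h (F.d i x) := by rw [hy]; abel
    rw [this, Finsupp.add_apply, map_add, F.minimal,
      cc_map h _ (fun b => F.minimal i x b), add_zero]

/-- Reduction mod `m` restricted to degree `j`. -/
noncomputable def red {B : Type} (deg : B → ℕ) (j : ℕ) (x : B →₀ MvPolynomial V k) :
    {b : B // deg b = j} →₀ k :=
  Finsupp.subtypeDomain (fun b => deg b = j)
    (Finsupp.mapRange (constantCoeff (σ := V) (R := k)) (map_zero _) x)

lemma red_apply {B : Type} (deg : B → ℕ) (j : ℕ) (x : B →₀ MvPolynomial V k) (b) :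
    red deg j x b = constantCoeff (x b.1) := rfl

/-- Reduction of a graded map in degree `j`. -/
noncomputable def redMap {B C : Type} (dB : B → ℕ) (dC : C → ℕ) (j : ℕ)
    (f : (B →₀ MvPolynomial V k) →ₗ[MvPolynomial V k] (C →₀ MvPolynomial V k)) :
    ({b : B // dB b = j} →₀ k) →ₗ[k] ({c : C // dC c = j} →₀ k) :=
  Finsupp.linearCombination k (fun b => red dC j (f (single b.1 1)))

lemma redMap_red {B C : Type} {dB : B → ℕ} {dC : C → ℕ} (j : ℕ)
    {f : (B →₀ MvPolynomial V k) →ₗ[MvPolynomial V k] (C →₀ MvPolynomial V k)}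
    (hf : GrMap dB dC f) (x) : redMap dB dC j f (red dB j x) = red dC j (f x) := by
  classical
  induction x using Finsupp.induction_linear with
  | zero =>
    have h1 : red dB j (0 : B →₀ MvPolynomial V k) = 0 := by ext b; simp [red_apply]
    have h2 : red dC j (0 : C →₀ MvPolynomial V k) = 0 := by ext b; simp [red_apply]
    rw [h1, map_zero, map_zero, h2]
  | add x y hx hy =>
    have h1 : red dB j (x + y) = red dB j x + red dB j y := by ext b; simp [red_apply]
    have h2 : red dC j (f x + f y) = red dC j (f x) + red dC j (f y) := by
      ext b; simp [red_apply]
    rw [h1, map_add, map_add, h2, hx, hy]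
  | single b r =>
    have e : f (single b r) = r • f (single b 1) := by
      rw [← map_smul, Finsupp.smul_single, smul_eq_mul, mul_one]
    by_cases h : dB b = j
    · have h1 : red dB j (single b r) = single ⟨b, h⟩ (constantCoeff r) := by
        ext c
        simp only [red_apply, Finsupp.single_apply, Subtype.ext_iff]
        split_ifs <;> simp
      rw [h1, redMap, Finsupp.linearCombination_single, e]
      ext c
      simp [red_apply]
    · have h1 : red dB j (single b r) = 0 := by
        ext c
        rw [red_apply, Finsupp.single_apply, if_neg]
        · simp
        · rintro rfl; exact h c.2
      rw [h1, map_zero, e]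
      ext c
      have hc := c.2
      obtain ⟨h3, h4⟩ := hf b c.1
      rw [red_apply, Finsupp.smul_apply, smul_eq_mul, map_mul]
      have : constantCoeff ((f (single b 1)) c.1) = 0 := by
        rcases h4 with h4 | h4
        · rw [constantCoeff_eq]
          apply h3.coeff_eq_zero
          simp only [map_zero]
          omega
        · rw [h4, map_zero]
      simp [this]

/-- Uniqueness of graded Betti numbers. -/
lemma GRes.card_eq {I : Ideal (MvPolynomial V k)} (F G : GRes I) (i j : ℕ) :
    Nat.card {b : F.B i // F.deg i b = j} = Nat.card {b : G.B i // G.deg i b = j} := by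
  have lift : ∀ F G : GRes I, ∃ f : ∀ i, (F.B i →₀ MvPolynomial V k) →ₗ[MvPolynomial V k]
      (G.B i →₀ MvPolynomial V k), (∀ x, f 0 x = single G.pt (x F.pt)) ∧
      (∀ i, GrMap (F.deg i) (G.deg i) (f i)) ∧
        ∀ i x, G.d i (f (i + 1) x) = f i (F.d i x) := by
    intro F G
    have hx : ∀ x, Finsupp.linearCombination (MvPolynomial V k)
        (fun _ : F.B 0 => (single G.pt 1 : G.B 0 →₀ MvPolynomial V k)) x =
          single G.pt (x F.pt) := by
      intro x
      have : x = single F.pt (x F.pt) := by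
        ext1 b; rw [F.uniq b]; simp
      rw [this]; simp
    obtain ⟨f, h0, h1, h2⟩ := exists_chain F.graded G.graded F.dd G.exact
      (Finsupp.linearCombination (MvPolynomial V k)
        (fun _ : F.B 0 => (single G.pt 1 : G.B 0 →₀ MvPolynomial V k)))
      (by
        intro b c
        rw [F.uniq b, G.uniq c, hx]
        simp [F.deg0, G.deg0, isHomogeneous_one])
      (by
        intro x
        rw [hx, G.exact0]
        have := (F.exact0 (F.d 0 x)).mp ⟨x, rfl⟩
        simpa using this)
    exact ⟨f, fun x => by rw [h0, hx], h1, h2⟩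
  obtain ⟨f, f0, f1, f2⟩ := lift F G
  obtain ⟨g, g0, g1, g2⟩ := lift G F
  have comp : ∀ (F G : GRes I) (f : ∀ i, (F.B i →₀ MvPolynomial V k) →ₗ[MvPolynomial V k]
      (G.B i →₀ MvPolynomial V k)) (g : ∀ i, (G.B i →₀ MvPolynomial V k) →ₗ[MvPolynomial V k]
      (F.B i →₀ MvPolynomial V k)), (∀ x, f 0 x = single G.pt (x F.pt)) →
      (∀ i, GrMap (F.deg i) (G.deg i) (f i)) →
      (∀ i x, G.d i (f (i + 1) x) = f i (F.d i x)) →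
      (∀ x, g 0 x = single F.pt (x G.pt)) →
      (∀ i, GrMap (G.deg i) (F.deg i) (g i)) →
      (∀ i x, F.d i (g (i + 1) x) = g i (G.d i x)) → ∀ i,
      redMap (G.deg i) (F.deg i) j (g i) ∘ₗ redMap (F.deg i) (G.deg i) j (f i) =
        LinearMap.id := by
    intro F G f g f0 f1 f2 g0 g1 g2 i
    classical
    apply Finsupp.lhom_ext'
    intro b
    apply LinearMap.ext_ring
    have hb : (single b 1 : {b : F.B i // F.deg i b = j} →₀ k) =
        red (F.deg i) j (single b.1 (1 : MvPolynomial V k)) := by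
      ext c
      simp only [red_apply, Finsupp.single_apply, Subtype.ext_iff]
      split_ifs <;> simp
    simp only [LinearMap.comp_apply, Finsupp.lsingle_apply, LinearMap.id_apply]
    rw [hb, redMap_red j (f1 i), redMap_red j (g1 i)]
    ext c
    rw [red_apply, red_apply]
    have := F.endo (fun i => g i ∘ₗ f i)
      (by
        intro x
        simp only [LinearMap.comp_apply, f0, g0]
        ext1 b; rw [F.uniq b]; simp)
      (by intro i x; simp only [LinearMap.comp_apply, g2, f2]) i (single b.1 1) c.1
    rw [Finsupp.sub_apply, map_sub, sub_eq_zero] at this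
    exact this
  have e : ({b : F.B i // F.deg i b = j} →₀ k) ≃ₗ[k] ({b : G.B i // G.deg i b = j} →₀ k) :=
    LinearEquiv.ofLinearMap _ _ (comp G F g f g0 g1 g2 f0 f1 f2 i) (comp F G f g f0 f1 f2 g0 g1 g2 i)
  exact Nat.card_congr ((Finsupp.basisSingleOne (R := k)).indexEquiv
    ((Finsupp.basisSingleOne (R := k)).map e.symm))

/-! ### Mapping cones -/

/-- Basis of the cone. -/
def coneBasis (C A : ℕ → Type) : ℕ → Type
  | 0 => C 0
  | i + 1 => C (i + 1) ⊕ A i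

/-- Degrees in the cone. -/
def coneDeg {C A : ℕ → Type} (degC : ∀ i, C i → ℕ) (degA : ∀ i, A i → ℕ) (s : ℕ) :
    ∀ i, coneBasis C A i → ℕ
  | 0 => degC 0
  | i + 1 => Sum.elim (degC (i + 1)) (fun a => degA i a + s)

/-- Differential of the cone. -/
noncomputable def coneD {C A : ℕ → Type}
    (dC : ∀ i, (C (i + 1) →₀ MvPolynomial V k) →ₗ[MvPolynomial V k] (C i →₀ MvPolynomial V k))
    (dA : ∀ i, (A (i + 1) →₀ MvPolynomial V k) →ₗ[MvPolynomial V k] (A i →₀ MvPolynomial V k))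
    (ψ : ∀ i, (A i →₀ MvPolynomial V k) →ₗ[MvPolynomial V k] (C i →₀ MvPolynomial V k)) :
    ∀ i, (coneBasis C A (i + 1) →₀ MvPolynomial V k) →ₗ[MvPolynomial V k]
      (coneBasis C A i →₀ MvPolynomial V k)
  | 0 => (LinearMap.coprod (dC 0) (ψ 0)) ∘ₗ
      (Finsupp.sumFinsuppLEquivProdFinsupp (MvPolynomial V k)).toLinearMap
  | i + 1 => (Finsupp.sumFinsuppLEquivProdFinsupp (MvPolynomial V k)).symm.toLinearMap ∘ₗ
      (LinearMap.prod (LinearMap.coprod (dC (i + 1)) (ψ (i + 1)))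
        (-(dA i ∘ₗ LinearMap.snd _ _ _))) ∘ₗ
      (Finsupp.sumFinsuppLEquivProdFinsupp (MvPolynomial V k)).toLinearMap

/-- shorthand for the identification of functions on a sum with a product -/
noncomputable abbrev SE (V k : Type) [Field k] (α β : Type) :
    (α ⊕ β →₀ MvPolynomial V k) ≃ₗ[MvPolynomial V k]
      (α →₀ MvPolynomial V k) × (β →₀ MvPolynomial V k) :=
  Finsupp.sumFinsuppLEquivProdFinsupp (MvPolynomial V k)

lemma SE_inl {α β : Type} (a : α) :
    SE V k α β (single (Sum.inl a) 1) = (single a 1, 0) := by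
  classical
  refine Prod.ext ?_ ?_
  · ext1 x; rw [Finsupp.fst_sumFinsuppLEquivProdFinsupp]; simp [Finsupp.single_apply]
  · ext1 x; rw [Finsupp.snd_sumFinsuppLEquivProdFinsupp]; simp [Finsupp.single_apply]

lemma SE_inr {α β : Type} (a : β) :
    SE V k α β (single (Sum.inr a) 1) = (0, single a 1) := by
  classical
  refine Prod.ext ?_ ?_
  · ext1 x; rw [Finsupp.fst_sumFinsuppLEquivProdFinsupp]; simp [Finsupp.single_apply]
  · ext1 x; rw [Finsupp.snd_sumFinsuppLEquivProdFinsupp]; simp [Finsupp.single_apply]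

lemma coneD_succ_apply {C A : ℕ → Type}
    (dC : ∀ i, (C (i + 1) →₀ MvPolynomial V k) →ₗ[MvPolynomial V k] (C i →₀ MvPolynomial V k))
    (dA : ∀ i, (A (i + 1) →₀ MvPolynomial V k) →ₗ[MvPolynomial V k] (A i →₀ MvPolynomial V k))
    (ψ : ∀ i, (A i →₀ MvPolynomial V k) →ₗ[MvPolynomial V k] (C i →₀ MvPolynomial V k))
    (i : ℕ) (v : (C (i + 2) ⊕ A (i + 1)) →₀ MvPolynomial V k) :
    SE V k (C (i + 1)) (A i) (coneD dC dA ψ (i + 1) v) =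
      (dC (i + 1) (SE V k _ _ v).1 + ψ (i + 1) (SE V k _ _ v).2, - dA i (SE V k _ _ v).2) := by
  change SE V k (C (i + 1)) (A i) ((SE V k (C (i + 1)) (A i)).symm
    (dC (i + 1) (SE V k _ _ v).1 + ψ (i + 1) (SE V k _ _ v).2, - dA i (SE V k _ _ v).2)) = _
  rw [LinearEquiv.apply_symm_apply]

lemma Hg_smul {B : Type} {deg : B → ℕ} {n e : ℕ} {x : B →₀ MvPolynomial V k}
    {y : MvPolynomial V k} (hy : y.IsHomogeneous e) (hx : Hg deg n x) : Hg deg (n + e) (y • x) := by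
  intro p
  obtain ⟨h1, h2⟩ := hx p
  rcases h2 with h2 | h2
  · refine ⟨?_, Or.inl (by omega)⟩
    have := hy.mul h1
    have e' : e + (n - deg p) = n + e - deg p := by omega
    rw [e'] at this
    exact this
  · rw [Finsupp.smul_apply, h2, smul_zero]; exact ⟨isHomogeneous_zero _ _ _, Or.inr rfl⟩

/-- The mapping cone construction. -/
lemma exists_cone {I J : Ideal (MvPolynomial V k)} (C : GRes I) (A : GRes J)
    {y z : MvPolynomial V k} {e e' : ℕ} (hy : y.IsHomogeneous e) (hz : z.IsHomogeneous e')
    (hy0 : constantCoeff y = 0) (h1 : ∀ a ∈ J, a * z ∈ I) (h2 : ∀ a, a * (y * z) ∈ I → a ∈ J) :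
    ∃ N : GRes (I ⊔ Ideal.span {y * z}), N.B = coneBasis C.B A.B ∧
      HEq N.deg (coneDeg C.deg A.deg (e + e')) := by
  have hA : ∀ x : A.B 0 →₀ MvPolynomial V k, x = single A.pt (x A.pt) := by
    intro x; ext1 b; rw [A.uniq b]; simp
  have hC : ∀ x : C.B 0 →₀ MvPolynomial V k, x = single C.pt (x C.pt) := by
    intro x; ext1 b; rw [C.uniq b]; simp
  have hx : ∀ x, Finsupp.linearCombination (MvPolynomial V k)
      (fun _ : A.B 0 => (single C.pt z : C.B 0 →₀ MvPolynomial V k)) x =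
        single C.pt (x A.pt * z) := by
    intro x
    rw [hA x]; simp
  obtain ⟨φ, φ0, φ1, φ2⟩ := exists_chain (degB := fun i a => A.deg i a + e') (degC := C.deg)
    (dB := A.d) (dC := C.d)
    (by
      intro i b c
      obtain ⟨h1, h2⟩ := A.graded i b c
      simp only [Nat.add_sub_add_right, add_le_add_iff_right]
      exact ⟨h1, h2⟩) C.graded A.dd C.exact
    (Finsupp.linearCombination (MvPolynomial V k)
      (fun _ : A.B 0 => (single C.pt z : C.B 0 →₀ MvPolynomial V k)))
    (by
      intro b c
      rw [C.uniq c, A.uniq b, hx]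
      simp [A.deg0, C.deg0, hz])
    (by
      intro x
      rw [hx, C.exact0]
      have := (A.exact0 (A.d 0 x)).mp ⟨x, rfl⟩
      simpa using h1 _ this)
  have φ0' : ∀ x, φ 0 x = single C.pt (x A.pt * z) := by intro x; rw [φ0, hx]
  clear hx φ0
  let ψ : ∀ i, (A.B i →₀ MvPolynomial V k) →ₗ[MvPolynomial V k] (C.B i →₀ MvPolynomial V k) :=
    fun i => y • φ i
  have ψ0 : ∀ x, ψ 0 x = single C.pt (x A.pt * (y * z)) := by
    intro x
    change y • φ 0 x = _
    rw [φ0', Finsupp.smul_single, smul_eq_mul]; congr 1; ring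
  have ψ1 : ∀ i a, Hg (C.deg i) (A.deg i a + (e + e')) (ψ i (single a 1)) := by
    intro i a
    have := Hg_smul hy (φ1 i a)
    have e1 : A.deg i a + e' + e = A.deg i a + (e + e') := by ring
    simp only [e1] at this
    exact this
  have ψ2 : ∀ i x, C.d i (ψ (i + 1) x) = ψ i (A.d i x) := by
    intro i x
    change C.d i (y • φ (i + 1) x) = y • φ i (A.d i x)
    rw [map_smul, φ2]
  have ψ3 : ∀ i x c, constantCoeff (ψ i x c) = 0 := by
    intro i x c
    change constantCoeff ((y • φ i x) c) = 0
    rw [Finsupp.smul_apply, smul_eq_mul, map_mul, hy0, zero_mul]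
  clear_value ψ
  clear φ0' φ1 φ2 φ
  refine ⟨⟨coneBasis C.B A.B, coneDeg C.deg A.deg (e + e'), coneD C.d A.d ψ, C.pt, C.uniq, C.deg0,
    ?_, ?_, ?_, ?_⟩, rfl, HEq.rfl⟩
  · intro x
    constructor
    · rintro ⟨w, rfl⟩
      change (C.d 0 (SE V k _ _ w).1 + ψ 0 (SE V k _ _ w).2) C.pt ∈ _
      rw [ψ0, Finsupp.add_apply, Finsupp.single_eq_same]
      refine Submodule.add_mem _ (Ideal.mem_sup_left ((C.exact0 _).mp ⟨_, rfl⟩)) ?_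
      exact Ideal.mem_sup_right (Ideal.mul_mem_left _ _ (Ideal.subset_span rfl))
    · intro h
      rw [Submodule.mem_sup] at h
      obtain ⟨u, hu, v, hv, huv⟩ := h
      obtain ⟨r, rfl⟩ := Ideal.mem_span_singleton'.mp hv
      obtain ⟨c, hc⟩ := (C.exact0 (single C.pt u)).mpr (by simpa using hu)
      refine ⟨(SE V k _ _).symm (c, single A.pt r), ?_⟩
      change C.d 0 (SE V k _ _ ((SE V k _ _).symm _)).1 +
        ψ 0 (SE V k _ _ ((SE V k _ _).symm _)).2 = _
      rw [LinearEquiv.apply_symm_apply]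
      simp only
      rw [hc, ψ0, hC x]
      simp only [Finsupp.single_eq_same]
      rw [← Finsupp.single_add, huv]
      rfl
  · intro i
    have core : ∀ (c : C.B (i + 1) →₀ MvPolynomial V k) (a : A.B i →₀ MvPolynomial V k),
        a ∈ LinearMap.range (A.d i) → C.d i c + ψ i a = 0 →
        ∃ c' a', C.d (i + 1) c' + ψ (i + 1) a' = c ∧ - A.d i a' = a := by
      rintro c a ⟨a', rfl⟩ h
      have : c + ψ (i + 1) a' ∈ LinearMap.ker (C.d i) := by
        rw [LinearMap.mem_ker, map_add, ψ2, h]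
      rw [C.exact] at this
      obtain ⟨c', hc'⟩ := this
      exact ⟨c', -a', by rw [hc', map_neg]; abel, by rw [map_neg, neg_neg]⟩
    have core' : ∀ c' a', C.d i (C.d (i + 1) c' + ψ (i + 1) a') + ψ i (- A.d i a') = 0 := by
      intro c' a'
      rw [map_add, C.dd, ψ2, map_neg]; abel
    have hr : ∀ w : (C.B (i + 1) ⊕ A.B i) →₀ MvPolynomial V k,
        w ∈ LinearMap.range (coneD C.d A.d ψ (i + 1)) ↔
        ∃ c' a', C.d (i + 1) c' + ψ (i + 1) a' = (SE V k _ _ w).1 ∧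
          - A.d i a' = (SE V k _ _ w).2 := by
      intro w
      constructor
      · rintro ⟨v, rfl⟩
        refine ⟨(SE V k (C.B (i + 2)) (A.B (i + 1)) v).1,
          (SE V k (C.B (i + 2)) (A.B (i + 1)) v).2, ?_, ?_⟩
        · exact (congrArg Prod.fst (coneD_succ_apply C.d A.d ψ i v)).symm
        · exact (congrArg Prod.snd (coneD_succ_apply C.d A.d ψ i v)).symm
      · rintro ⟨c', a', h1, h2⟩
        refine ⟨(SE V k _ _).symm (c', a'), ?_⟩
        apply (SE V k _ _).injective
        refine (coneD_succ_apply C.d A.d ψ i _).trans ?_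
        rw [LinearEquiv.apply_symm_apply]
        exact Prod.ext h1 h2
    ext w
    refine Iff.trans ?_ (hr w).symm
    cases i with
    | zero =>
      change C.d 0 (SE V k _ _ w).1 + ψ 0 (SE V k _ _ w).2 = 0 ↔ _
      constructor
      · intro h
        refine core _ _ ?_ h
        rw [A.exact0]
        apply h2
        have h3 := congrArg (fun f => f C.pt) h
        simp only [Finsupp.add_apply, ψ0, Finsupp.single_eq_same, Finsupp.zero_apply] at h3
        rw [← neg_eq_iff_add_eq_zero] at h3
        rw [← h3]
        exact I.neg_mem ((C.exact0 _).mp ⟨_, rfl⟩)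
      · rintro ⟨c', a', h1, h2⟩
        rw [← h1, ← h2]
        exact core' _ _
    | succ i =>
      have : w ∈ LinearMap.ker (coneD C.d A.d ψ (i + 1)) ↔
          C.d (i + 1) (SE V k _ _ w).1 + ψ (i + 1) (SE V k _ _ w).2 = 0 ∧
            A.d i (SE V k _ _ w).2 = 0 := by
        change (SE V k _ _).symm (C.d (i + 1) (SE V k _ _ w).1 + ψ (i + 1) (SE V k _ _ w).2,
          - A.d i (SE V k _ _ w).2) = 0 ↔ _
        rw [LinearEquiv.map_eq_zero_iff, Prod.mk_eq_zero, neg_eq_zero]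
      refine this.trans ?_
      constructor
      · rintro ⟨h, h'⟩
        refine core _ _ ?_ h
        rw [← A.exact]; exact h'
      · rintro ⟨c', a', h1, h2⟩
        rw [← h1, ← h2]
        refine ⟨core' _ _, ?_⟩
        rw [map_neg, A.dd, neg_zero]
  · intro i x p
    cases i with
    | zero =>
      have : ∀ u v (p : C.B 0), constantCoeff ((C.d 0 u + ψ 0 v) p) = 0 := by
        intro u v p
        rw [Finsupp.add_apply, map_add, C.minimal, ψ3, add_zero]
      exact this _ _ _
    | succ i =>
      cases p with
      | inl p =>
        change constantCoeff ((C.d (i + 1) (SE V k _ _ x).1 + ψ (i + 1) (SE V k _ _ x).2) p) = 0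
        rw [Finsupp.add_apply, map_add, C.minimal, ψ3, add_zero]
      | inr p =>
        change constantCoeff ((- A.d i (SE V k _ _ x).2) p) = 0
        rw [Finsupp.neg_apply, map_neg, A.minimal, neg_zero]
  · intro i b
    cases i with
    | zero =>
      cases b with
      | inl b =>
        change Hg (C.deg 0) (C.deg 1 b) (C.d 0 (SE V k _ _ (single (Sum.inl b) 1)).1 +
          ψ 0 (SE V k _ _ (single (Sum.inl b) 1)).2)
        rw [SE_inl]
        simpa using C.graded 0 b
      | inr b =>
        change Hg (C.deg 0) (A.deg 0 b + (e + e')) (C.d 0 (SE V k _ _ (single (Sum.inr b) 1)).1 +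
          ψ 0 (SE V k _ _ (single (Sum.inr b) 1)).2)
        rw [SE_inr]
        simpa using ψ1 0 b
    | succ i =>
      cases b with
      | inl b =>
        intro p
        cases p with
        | inl p =>
          have : Hg (C.deg (i + 1)) (C.deg (i + 2) b)
            (C.d (i + 1) (SE V k _ (A.B (i + 1)) (single (Sum.inl b) 1)).1 +
              ψ (i + 1) (SE V k _ _ (single (Sum.inl b) 1)).2) := by
            rw [SE_inl]
            simpa using C.graded (i + 1) b
          exact this p
        | inr p =>
          have : ((coneD C.d A.d ψ (i + 1)) (single (Sum.inl b) 1)) (Sum.inr p) = 0 := by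
            change (- A.d i (SE V k _ _ (single (Sum.inl b) 1)).2) p = 0
            rw [SE_inl]; simp
          refine ⟨?_, Or.inr this⟩
          exact this ▸ isHomogeneous_zero _ _ _
      | inr b =>
        intro p
        cases p with
        | inl p =>
          have : Hg (C.deg (i + 1)) (A.deg (i + 1) b + (e + e'))
            (C.d (i + 1) (SE V k (C.B (i + 2)) _ (single (Sum.inr b) 1)).1 +
              ψ (i + 1) (SE V k (C.B (i + 2)) _ (single (Sum.inr b) 1)).2) := by
            rw [SE_inr]
            simpa using ψ1 (i + 1) b
          exact this p
        | inr p =>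
          have h3 : ((coneD C.d A.d ψ (i + 1)) (single (Sum.inr b) 1)) (Sum.inr p) =
              - (A.d i (single b 1)) p := by
            change (- A.d i (SE V k _ _ (single (Sum.inr b) 1)).2) p = _
            rw [SE_inr]; simp
          obtain ⟨h4, h5⟩ := A.graded i b p
          have h6 : coneDeg C.deg A.deg (e + e') (i + 1 + 1) (Sum.inr b) -
            coneDeg C.deg A.deg (e + e') (i + 1) (Sum.inr p) =
              A.deg (i + 1) b - A.deg i p := Nat.add_sub_add_right _ _ _
          refine ⟨?_, ?_⟩
          · have h7 := h4.neg
            rw [← h6, ← h3] at h7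
            exact h7
          · rcases h5 with h5 | h5
            · exact Or.inl (Nat.add_le_add_right h5 _)
            · exact Or.inr (h3.trans (by rw [h5, neg_zero]))

/-- The ideal has a minimal graded free resolution with the given (finite) Betti numbers. -/
def HasBetti (I : Ideal (MvPolynomial V k)) (b : ℕ → ℕ → ℕ) : Prop :=
  ∃ G : GRes I, (∀ i, Finite (G.B i)) ∧ ∀ i j, Nat.card {x : G.B i // G.deg i x = j} = b i j

/-- Betti numbers of the cone. -/
def coneBetti (b a : ℕ → ℕ → ℕ) (s : ℕ) : ℕ → ℕ → ℕ
  | 0, j => b 0 j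
  | i + 1, j => b (i + 1) j + if s ≤ j then a i (j - s) else 0

lemma HasBetti.cone {I J : Ideal (MvPolynomial V k)} {a b : ℕ → ℕ → ℕ}
    (hI : HasBetti I b) (hJ : HasBetti J a)
    {y z : MvPolynomial V k} {e e' : ℕ} (hy : y.IsHomogeneous e) (hz : z.IsHomogeneous e')
    (hy0 : constantCoeff y = 0) (h1 : ∀ a ∈ J, a * z ∈ I) (h2 : ∀ a, a * (y * z) ∈ I → a ∈ J) :
    HasBetti (I ⊔ Ideal.span {y * z}) (coneBetti b a (e + e')) := by
  obtain ⟨C, fC, hC⟩ := hI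
  obtain ⟨A, fA, hA⟩ := hJ
  obtain ⟨⟨B, deg, d, pt, u1, u2, u3, u4, u5, u6⟩, hB, hdeg⟩ := exists_cone C A hy hz hy0 h1 h2
  dsimp only at hB hdeg
  subst hB
  have hdeg := eq_of_heq hdeg
  subst hdeg
  refine ⟨⟨_, _, d, pt, u1, u2, u3, u4, u5, u6⟩, ?_, ?_⟩
  · intro i
    cases i with
    | zero => exact fC 0
    | succ i =>
      have := fC (i + 1)
      have := fA i
      exact (inferInstance : Finite (C.B (i + 1) ⊕ A.B i))
  · intro i j
    cases i with
    | zero => exact hC 0 j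
    | succ i =>
      have := fC (i + 1)
      have := fA i
      change Nat.card {x : C.B (i + 1) ⊕ A.B i //
        Sum.elim (C.deg (i + 1)) (fun a => A.deg i a + (e + e')) x = j} = _
      rw [Nat.card_congr (Equiv.subtypeSum), Nat.card_sum]
      simp only [Sum.elim_inl, Sum.elim_inr]
      rw [hC, coneBetti]
      congr 1
      split_ifs with h
      · rw [← hA]
        apply Nat.card_congr
        apply Equiv.subtypeEquivRight
        intro x
        omega
      · have : IsEmpty {a : A.B i // A.deg i a + (e + e') = j} := ⟨fun x => by have := x.2; omega⟩
        exact Nat.card_of_isEmpty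

/-- Basis of the resolution of the zero ideal. -/
def botB : ℕ → Type
  | 0 => Unit
  | _ + 1 => Empty

lemma hasBetti_bot : HasBetti (⊥ : Ideal (MvPolynomial V k))
    (fun i j => if i = 0 ∧ j = 0 then 1 else 0) := by
  refine ⟨⟨botB, fun _ _ => 0,
    fun i => (0 : (botB (i + 1) →₀ MvPolynomial V k) →ₗ[MvPolynomial V k]
      (botB i →₀ MvPolynomial V k)),
    (), fun b => rfl, fun _ => rfl, ?_, ?_, ?_, ?_⟩, ?_, ?_⟩
  · intro x
    rw [LinearMap.range_zero, Submodule.mem_bot, Submodule.mem_bot]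
    constructor
    · rintro rfl; rfl
    · intro h; ext1 b; exact h
  · intro i
    ext x
    have : x = 0 := by ext1 b; exact Empty.elim b
    simp [this]
  · intros; simp
  · intro i b; exact Empty.elim b
  · intro i
    cases i with
    | zero => exact (inferInstance : Finite Unit)
    | succ i => exact (inferInstance : Finite Empty)
  · intro i j
    cases i with
    | zero =>
      change Nat.card {x : Unit // 0 = j} = _
      by_cases h : j = 0
      · subst h; simp
      · have : IsEmpty {x : Unit // 0 = j} := ⟨fun x => h x.2.symm⟩
        rw [Nat.card_of_isEmpty]; simp [h]
    | succ i =>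
      change Nat.card {x : Empty // 0 = j} = _
      simp

/-! ### Squarefree monomial ideals -/

/-- The squarefree monomial of a finset. -/
noncomputable def xm (k : Type) {V : Type} [Field k] (T : Finset V) : MvPolynomial V k :=
  ∏ v ∈ T, X v

/-- The exponent vector of a squarefree monomial. -/
noncomputable def ind {V : Type} (T : Finset V) : V →₀ ℕ := ∑ v ∈ T, single v 1

/-- The ideal generated by squarefree monomials. -/
noncomputable def IS (k : Type) {V : Type} [Field k] (S : Set (Finset V)) :
    Ideal (MvPolynomial V k) := Ideal.span (xm k '' S)

lemma xm_eq (T : Finset V) : xm k T = monomial (ind T) 1 := by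
  rw [xm, ind, monomial_sum_one]; rfl

lemma ind_apply [DecidableEq V] (T : Finset V) (v : V) : ind T v = if v ∈ T then 1 else 0 := by
  rw [ind, Finsupp.finsetSum_apply]
  simp [Finsupp.single_apply]

lemma mem_IS {S : Set (Finset V)} {f : MvPolynomial V k} :
    f ∈ IS k S ↔ ∀ s ∈ f.support, ∃ T ∈ S, ind T ≤ s := by
  have : IS k S = Ideal.span ((fun s => monomial s (1 : k)) '' (ind '' S)) := by
    rw [IS, Set.image_image]
    simp only [← xm_eq]
  rw [this, mem_ideal_span_monomial_image]
  simp

lemma xm_homog (T : Finset V) : (xm k T).IsHomogeneous T.card := by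
  have := IsHomogeneous.prod T (fun v => (X v : MvPolynomial V k)) (fun _ => 1)
    (fun v _ => isHomogeneous_X k v)
  rw [xm]
  simpa using this

lemma xm_cc {T : Finset V} (h : T.Nonempty) : constantCoeff (xm k T) = 0 := by
  obtain ⟨v, hv⟩ := h
  rw [xm, map_prod]
  exact Finset.prod_eq_zero hv (by simp)

lemma IS_cone [DecidableEq V] {S J : Set (Finset V)} {a b : ℕ → ℕ → ℕ}
    (hS : HasBetti (IS k S) b) (hJ : HasBetti (IS k J) a) (Y Z : Finset V)
    (hYZ : Disjoint Y Z) (hY : Y.Nonempty)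
    (h1 : ∀ T ∈ J, ∃ T' ∈ S, T' ⊆ T ∪ Z)
    (h2 : ∀ T ∈ S, ∃ T' ∈ J, T' ⊆ T \ (Y ∪ Z)) :
    HasBetti (IS k (insert (Y ∪ Z) S)) (coneBetti b a (Y.card + Z.card)) := by
  have hmul : xm k Y * xm k Z = xm k (Y ∪ Z) := (Finset.prod_union hYZ).symm
  have e : IS k (insert (Y ∪ Z) S) = IS k S ⊔ Ideal.span {xm k Y * xm k Z} := by
    rw [IS, Set.image_insert_eq, Ideal.span_insert, sup_comm, hmul]; rfl
  rw [e]
  refine hS.cone hJ (xm_homog Y) (xm_homog Z) (xm_cc hY) ?_ ?_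
  · intro f hf
    rw [IS] at hf
    induction hf using Submodule.span_induction with
    | mem x hx =>
      obtain ⟨T, hT, rfl⟩ := hx
      obtain ⟨T', hT', hs⟩ := h1 T hT
      have d1 : xm k T' ∣ xm k (T ∪ Z) := Finset.prod_dvd_prod_of_subset _ _ _ hs
      have d2 : xm k (T ∪ Z) ∣ xm k T * xm k Z :=
        ⟨xm k (T ∩ Z), Finset.prod_union_inter.symm⟩
      exact Ideal.mem_of_dvd _ (d1.trans d2) (Ideal.subset_span ⟨T', hT', rfl⟩)
    | zero => rw [zero_mul]; exact Submodule.zero_mem _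
    | add x y _ _ hx hy => rw [add_mul]; exact Submodule.add_mem _ hx hy
    | smul r x _ hx => rw [smul_eq_mul, mul_assoc]; exact Ideal.mul_mem_left _ _ hx
  · intro f hf
    rw [hmul, xm_eq] at hf
    rw [mem_IS] at hf ⊢
    intro s hs
    obtain ⟨T, hT, hle⟩ := hf (s + ind (Y ∪ Z)) (by
      rw [MvPolynomial.mem_support_iff, coeff_mul_monomial, mul_one]
      exact MvPolynomial.mem_support_iff.mp hs)
    obtain ⟨T', hT', hsub⟩ := h2 T hT
    refine ⟨T', hT', ?_⟩
    intro v
    rw [ind_apply]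
    split_ifs with hv
    · have h3 := hle v
      have h4 := hsub hv
      rw [Finset.mem_sdiff] at h4
      rw [Finsupp.add_apply, ind_apply, ind_apply, if_pos h4.1, if_neg h4.2] at h3
      omega
    · exact Nat.zero_le _

/-- Rescaling of Betti numbers. -/
def scaleB (α : ℕ) (b : ℕ → ℕ → ℕ) : ℕ → ℕ → ℕ :=
  fun i j => if α ∣ j then b i (j / α) else 0

lemma coneBetti_scale {α : ℕ} (hα : 0 < α) (b a : ℕ → ℕ → ℕ) (t : ℕ) :
    coneBetti (scaleB α b) (scaleB α a) (t * α) = scaleB α (coneBetti b a t) := by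
  funext i j
  cases i with
  | zero => rfl
  | succ i =>
    by_cases h : α ∣ j
    · obtain ⟨c, rfl⟩ := h
      have e1 : α * c / α = c := Nat.mul_div_cancel_left _ hα
      have e2 : α * c - t * α = α * (c - t) := by rw [mul_comm t, Nat.mul_sub]
      have e3 : t * α ≤ α * c ↔ t ≤ c := by
        rw [mul_comm t]; exact Nat.mul_le_mul_left_iff hα
      simp only [coneBetti, scaleB, e1, e2, e3, Nat.dvd_mul_right, if_true,
        Nat.mul_div_cancel_left _ hα]
    · have : t * α ≤ j → ¬ α ∣ j - t * α := by
        intro hle hd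
        apply h
        have := (Nat.dvd_sub_iff_left hle (Nat.dvd_mul_left α t)).mp hd
        exact this
      simp only [coneBetti, scaleB, if_neg h, zero_add]
      split_ifs with h1 h2
      · exact absurd h2 (this h1)
      · rfl
      · rfl

/-- Betti numbers of the path. -/
def pathB : ℕ → ℕ → ℕ → ℕ
  | 0 => fun i j => if i = 0 ∧ j = 0 then 1 else 0
  | 1 => coneBetti (pathB 0) (pathB 0) 2
  | 2 => coneBetti (pathB 1) (coneBetti (pathB 0) (pathB 0) 1) 2
  | n + 3 => coneBetti (pathB (n + 2)) (coneBetti (pathB n) (pathB n) 1) 2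

/-- Edges of the path on blocks. -/
def PS [DecidableEq V] (B : ℕ → Finset V) (m : ℕ) : Set (Finset V) :=
  {T | ∃ i < m, T = B i ∪ B (i + 1)}

lemma PS_succ [DecidableEq V] (B : ℕ → Finset V) (m : ℕ) :
    PS B (m + 1) = insert (B (m + 1) ∪ B m) (PS B m) := by
  ext T
  simp only [PS, Set.mem_ofPred_eq, Set.mem_insert_iff]
  constructor
  · rintro ⟨i, hi, rfl⟩
    rcases Nat.lt_succ_iff_lt_or_eq.mp hi with h | rfl
    · exact Or.inr ⟨i, h, rfl⟩
    · exact Or.inl (Finset.union_comm _ _)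
  · rintro (rfl | ⟨i, hi, rfl⟩)
    · exact ⟨m, Nat.lt_succ_self m, Finset.union_comm _ _⟩
    · exact ⟨i, by omega, rfl⟩

lemma path_hasBetti [DecidableEq V] {B : ℕ → Finset V} {n α : ℕ} (hα : 0 < α)
    (hcard : ∀ i ≤ n, (B i).card = α)
    (hdisj : ∀ i j, i < j → j ≤ n → Disjoint (B i) (B j)) :
    ∀ m ≤ n, HasBetti (IS k (PS B m)) (scaleB α (pathB m)) := by
  have hdisj' : ∀ i j, i ≠ j → i ≤ n → j ≤ n → Disjoint (B i) (B j) := by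
    intro i j hij hi hj
    rcases lt_or_gt_of_ne hij with h | h
    · exact hdisj i j h hj
    · exact (hdisj j i h hi).symm
  have hne : ∀ i ≤ n, (B i).Nonempty := by
    intro i hi; rw [← Finset.card_pos, hcard i hi]; exact hα
  have hsd : ∀ i a b, i ≤ n → a ≤ n → b ≤ n → i ≠ a → i ≠ b → ∀ T, B i ⊆ T →
      B i ⊆ T \ (B a ∪ B b) := by
    intro i a b hi ha hb h1 h2 T hT
    rw [Finset.subset_sdiff, Finset.disjoint_union_right]
    exact ⟨hT, hdisj' _ _ h1 hi ha, hdisj' _ _ h2 hi hb⟩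
  have h0 : HasBetti (IS k (PS B 0)) (scaleB α (pathB 0)) := by
    have e1 : IS k (PS B 0) = ⊥ := by simp [IS, PS]
    rw [e1]
    convert (hasBetti_bot : HasBetti (⊥ : Ideal (MvPolynomial V k)) _) using 1
    funext i j
    by_cases h : α ∣ j
    · obtain ⟨c, rfl⟩ := h
      simp [scaleB, pathB, hα.ne']
    · have : j ≠ 0 := by rintro rfl; exact h (dvd_zero _)
      simp [scaleB, h, this]
  -- adjoining a block disjoint from all the edges
  have hvar : ∀ l w, (l < w ∨ l = 0) → w ≤ n → HasBetti (IS k (PS B l)) (scaleB α (pathB l)) →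
      HasBetti (IS k (insert (B w) (PS B l)))
        (scaleB α (coneBetti (pathB l) (pathB l) 1)) := by
    intro l w hl hw h
    have := IS_cone h h (B w) ∅ (Finset.disjoint_empty_right _) (hne w hw)
      (fun T hT => ⟨T, hT, by simp⟩) (by
        rintro T ⟨i, hi, rfl⟩
        refine ⟨_, ⟨i, hi, rfl⟩, ?_⟩
        rw [Finset.union_empty, Finset.subset_sdiff]
        refine ⟨subset_rfl, ?_⟩
        rw [Finset.disjoint_union_left]
        exact ⟨hdisj _ _ (by omega) hw, hdisj _ _ (by omega) hw⟩)
    rw [Finset.union_empty, Finset.card_empty, hcard w hw, add_zero] at this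
    rw [← coneBetti_scale hα, one_mul]
    exact this
  intro m
  induction m using Nat.strong_induction_on with
  | _ m ih =>
    intro hm
    match m, ih, hm with
    | 0, _, _ => exact h0
    | 1, _, hm =>
      have := IS_cone h0 h0 (B 1) (B 0) (hdisj' _ _ (by omega) (by omega) (by omega))
        (hne 1 hm) (by rintro T ⟨i, hi, _⟩; omega) (by rintro T ⟨i, hi, _⟩; omega)
      rw [hcard 1 hm, hcard 0 (by omega), ← two_mul, coneBetti_scale hα, ← PS_succ] at this
      exact this
    | 2, ih, hm =>
      have := IS_cone (ih 1 (by omega) (by omega)) (hvar 0 0 (by omega) (by omega) h0)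
        (B 2) (B 1) (hdisj' _ _ (by omega) (by omega) (by omega))
        (hne _ hm) (by
          rintro T (rfl | ⟨i, hi, rfl⟩)
          · exact ⟨_, ⟨0, by omega, rfl⟩, subset_rfl⟩
          · omega) (by
          rintro T ⟨i, hi, rfl⟩
          obtain rfl : i = 0 := by omega
          exact ⟨_, Or.inl rfl, hsd _ _ _ (by omega) (by omega) (by omega) (by omega)
              (by omega) _ Finset.subset_union_left⟩)
      rw [hcard _ hm, hcard _ (by omega), ← two_mul, coneBetti_scale hα, ← PS_succ] at this
      exact this
    | l + 3, ih, hm =>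
      have := IS_cone (ih (l + 2) (by omega) (by omega))
        (hvar l (l + 1) (by omega) (by omega) (ih l (by omega) (by omega)))
        (B (l + 3)) (B (l + 2)) (hdisj' _ _ (by omega) (by omega) (by omega))
        (hne _ hm) (by
          rintro T (rfl | ⟨i, hi, rfl⟩)
          · exact ⟨_, ⟨l + 1, by omega, rfl⟩, subset_rfl⟩
          · exact ⟨_, ⟨i, by omega, rfl⟩, Finset.subset_union_left⟩) (by
          rintro T ⟨i, hi, rfl⟩
          rcases (by omega : i = l ∨ i = l + 1 ∨ i < l) with rfl | rfl | h
          · exact ⟨_, Or.inl rfl, hsd _ _ _ (by omega) (by omega) (by omega) (by omega)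
              (by omega) _ Finset.subset_union_right⟩
          · exact ⟨_, Or.inl rfl, hsd _ _ _ (by omega) (by omega) (by omega) (by omega)
              (by omega) _ Finset.subset_union_left⟩
          · refine ⟨_, Or.inr ⟨i, h, rfl⟩, Finset.union_subset ?_ ?_⟩
            · exact hsd _ _ _ (by omega) (by omega) (by omega) (by omega)
                (by omega) _ Finset.subset_union_left
            · exact hsd _ _ _ (by omega) (by omega) (by omega) (by omega)
                (by omega) _ Finset.subset_union_right)
      rw [hcard _ hm, hcard _ (by omega), ← two_mul, coneBetti_scale hα, ← PS_succ] at this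
      exact this

/-! ### The closed formula -/

/-- Reindexing `i = p + q`, `j = 2 p + q`. -/
def fr (f : ℕ → ℕ → ℕ) : ℕ → ℕ → ℕ :=
  fun i j => if i ≤ j ∧ j ≤ 2 * i then f (j - i) (2 * i - j) else 0

lemma fr_eq (f : ℕ → ℕ → ℕ) (p q i j : ℕ) (hi : i = p + q) (hj : j = 2 * p + q) :
    fr f i j = f p q := by
  have e1 : j - i = p := by omega
  have e2 : 2 * i - j = q := by omega
  rw [fr, if_pos (by omega), e1, e2]

lemma fr_zero (f : ℕ → ℕ → ℕ) (i j : ℕ) (h : ¬ (i ≤ j ∧ j ≤ 2 * i)) : fr f i j = 0 := if_neg h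

/-- shift in the first index -/
def shp (g : ℕ → ℕ → ℕ) : ℕ → ℕ → ℕ
  | 0, _ => 0
  | p + 1, q => g p q

/-- shift in the second index -/
def shq (g : ℕ → ℕ → ℕ) : ℕ → ℕ → ℕ
  | _, 0 => 0
  | p, q + 1 => g p q

lemma coneBetti_two (f g : ℕ → ℕ → ℕ) :
    coneBetti (fr f) (fr g) 2 = fr (fun p q => f p q + shp g p q) := by
  funext i j
  by_cases h : i ≤ j ∧ j ≤ 2 * i
  · obtain ⟨p, q, hi, hj⟩ : ∃ p q, i = p + q ∧ j = 2 * p + q :=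
      ⟨j - i, 2 * i - j, by omega, by omega⟩
    rw [fr_eq _ p q i j hi hj]
    cases i with
    | zero =>
      obtain rfl : p = 0 := by omega
      rw [coneBetti, fr_eq _ 0 q _ _ hi hj]; rfl
    | succ i =>
      rw [coneBetti, fr_eq _ p q _ _ hi hj]
      congr 1
      cases p with
      | zero =>
        split_ifs with h2
        · exact fr_zero _ _ _ (by omega)
        · rfl
      | succ p => rw [if_pos (by omega), fr_eq _ p q _ _ (by omega) (by omega)]; rfl
  · rw [fr_zero _ _ _ h]
    cases i with
    | zero => exact fr_zero _ _ _ h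
    | succ i =>
      rw [coneBetti, fr_zero _ _ _ h, zero_add]
      split_ifs with h2
      · exact fr_zero _ _ _ (by omega)
      · rfl

lemma coneBetti_one (f g : ℕ → ℕ → ℕ) :
    coneBetti (fr f) (fr g) 1 = fr (fun p q => f p q + shq g p q) := by
  funext i j
  by_cases h : i ≤ j ∧ j ≤ 2 * i
  · obtain ⟨p, q, hi, hj⟩ : ∃ p q, i = p + q ∧ j = 2 * p + q :=
      ⟨j - i, 2 * i - j, by omega, by omega⟩
    rw [fr_eq _ p q i j hi hj]
    cases i with
    | zero =>
      obtain rfl : q = 0 := by omega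
      rw [coneBetti, fr_eq _ p 0 _ _ hi hj]; rfl
    | succ i =>
      rw [coneBetti, fr_eq _ p q _ _ hi hj]
      congr 1
      cases q with
      | zero =>
        split_ifs with h2
        · exact fr_zero _ _ _ (by omega)
        · rfl
      | succ q => rw [if_pos (by omega), fr_eq _ p q _ _ (by omega) (by omega)]; rfl
  · rw [fr_zero _ _ _ h]
    cases i with
    | zero => exact fr_zero _ _ _ h
    | succ i =>
      rw [coneBetti, fr_zero _ _ _ h, zero_add]
      split_ifs with h2
      · exact fr_zero _ _ _ (by omega)
      · rfl

/-- closed form -/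
def cl (n p q : ℕ) : ℕ :=
  match p with
  | 0 => Nat.choose 0 q
  | p + 1 => if 2 * (p + 1) ≤ n + 1 then
      (p + 1).choose q * (n + 1 - 2 * (p + 1)).choose (p + 1) +
        p.choose q * (n + 1 - 2 * (p + 1)).choose p else 0

lemma cl_rec (n p q : ℕ) :
    cl (n + 3) p q = cl (n + 2) p q + shp (fun p q => cl n p q + shq (cl n) p q) p q := by
  match p with
  | 0 => rfl
  | 1 =>
    simp only [cl, shp]
    obtain ⟨M, hM⟩ : ∃ M, M = n + 1 := ⟨_, rfl⟩
    have e1 : n + 3 + 1 - 2 * (0 + 1) = M + 1 := by omega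
    have e2 : n + 2 + 1 - 2 * (0 + 1) = M := by omega
    rw [if_pos (by omega), if_pos (by omega), e1, e2]
    match q with
    | 0 => simp [shq]
    | 1 => simp [shq, cl]
    | q + 2 => simp [shq, cl, Nat.choose_succ_succ]
  | p + 2 =>
    have hc : cl n (p + 1) q + shq (cl n) (p + 1) q = if 2 * (p + 1) ≤ n + 1 then
      (p + 2).choose q * (n + 1 - 2 * (p + 1)).choose (p + 1) +
        (p + 1).choose q * (n + 1 - 2 * (p + 1)).choose p else 0 := by
      cases q with
      | zero => simp [shq, cl]
      | succ q =>
        have a1 : (p + 2).choose (q + 1) = (p + 1).choose q + (p + 1).choose (q + 1) :=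
          Nat.choose_succ_succ (p + 1) q
        have a2 : (p + 1).choose (q + 1) = p.choose q + p.choose (q + 1) :=
          Nat.choose_succ_succ p q
        simp only [shq, cl]
        rw [a1]
        split_ifs
        · generalize (n + 1 - 2 * (p + 1)).choose (p + 1) = x
          generalize (n + 1 - 2 * (p + 1)).choose p = y
          rw [a2]
          ring
        · rfl
    simp only [shp]
    rw [hc]
    simp only [cl]
    by_cases h : 2 * (p + 1) ≤ n + 1
    · obtain ⟨M, hM⟩ := Nat.exists_eq_add_of_le h
      have e1 : n + 3 + 1 - 2 * (p + 1 + 1) = M + 1 := by omega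
      have e2 : n + 2 + 1 - 2 * (p + 1 + 1) = M := by omega
      have e3 : n + 1 - 2 * (p + 1) = M := by omega
      rw [if_pos (by omega), if_pos (by omega), if_pos h, e1, e2, e3,
        Nat.choose_succ_succ M (p + 1), Nat.choose_succ_succ M p]
      simp only [Nat.succ_eq_add_one]
      ring
    · rw [if_neg h, if_neg (show ¬ 2 * (p + 1 + 1) ≤ n + 2 + 1 by omega)]
      split_ifs with h2
      · have e1 : n + 3 + 1 - 2 * (p + 1 + 1) = 0 := by omega
        rw [e1]; simp
      · rfl

lemma pathB_eq (n : ℕ) : pathB n = fr (cl n) := by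
  have h0 : pathB 0 = fr (cl 0) := by
    funext i j
    by_cases h : i ≤ j ∧ j ≤ 2 * i
    · obtain ⟨p, q, hi, hj⟩ : ∃ p q, i = p + q ∧ j = 2 * p + q :=
        ⟨j - i, 2 * i - j, by omega, by omega⟩
      rw [fr_eq _ p q i j hi hj]
      subst hi hj
      cases p with
      | zero => cases q <;> simp [pathB, cl]
      | succ p =>
        have h1 : ¬ 2 * (p + 1) ≤ 0 + 1 := by omega
        have h2 : ¬ (p + 1 + q = 0 ∧ 2 * (p + 1) + q = 0) := by omega
        simp only [pathB, cl]
        rw [if_neg h1, if_neg h2]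
    · rw [fr_zero _ _ _ h]
      change (if i = 0 ∧ j = 0 then 1 else 0) = 0
      rw [if_neg (by omega)]
  induction n using Nat.strong_induction_on with
  | _ n ih =>
    match n, ih with
    | 0, _ => exact h0
    | 1, _ =>
      rw [pathB, h0, coneBetti_two]
      congr 1
      funext p q
      match p with
      | 0 => rfl
      | 1 => simp [cl, shp]
      | p + 2 => simp [cl, shp]; omega
    | 2, ih =>
      rw [pathB, h0, ih 1 (by omega), coneBetti_one, coneBetti_two]
      congr 1
      funext p q
      match p with
      | 0 => rfl
      | 1 =>
        match q with
        | 0 => simp [cl, shp, shq]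
        | 1 => simp [cl, shp, shq]
        | q + 2 => simp [cl, shp, shq, Nat.choose_succ_succ]
      | p + 2 =>
        have h1 : ¬ 2 * (p + 1) ≤ 1 := by omega
        have h2 : ¬ 2 * (p + 1 + 1) ≤ 2 + 1 := by omega
        have h3 : ¬ 2 * (p + 1 + 1) ≤ 1 + 1 := by omega
        cases q <;> simp only [cl, shp, shq, zero_add, if_neg h1, if_neg h2, if_neg h3]
    | n + 3, ih =>
      rw [pathB, ih n (by omega), ih (n + 2) (by omega), coneBetti_one, coneBetti_two]
      congr 1
      funext p q
      rw [cl_rec]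

lemma intChoose_nat (a b : ℕ) : intChoose a b = a.choose b := by simp [intChoose]

lemma intChoose_neg_left (a b : ℤ) (h : a < 0) : intChoose a b = 0 :=
  if_neg fun h' => absurd h'.1 (not_le.mpr h)

lemma intChoose_neg_right (a b : ℤ) (h : b < 0) : intChoose a b = 0 :=
  if_neg fun h' => absurd h'.2 (not_le.mpr h)

lemma closed_form (n i j : ℕ) : fr (cl n) i j =
    intChoose ((j : ℤ) - i) (2 * i - j) * intChoose ((n : ℤ) + 1 - 2 * j + 2 * i) ((j : ℤ) - i) +
      intChoose ((j : ℤ) - i - 1) (2 * i - j) *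
        intChoose ((n : ℤ) + 1 - 2 * j + 2 * i) ((j : ℤ) - i - 1) := by
  by_cases h : i ≤ j ∧ j ≤ 2 * i
  · obtain ⟨p, q, hi, hj⟩ : ∃ p q, i = p + q ∧ j = 2 * p + q :=
      ⟨j - i, 2 * i - j, by omega, by omega⟩
    rw [fr_eq _ p q i j hi hj]
    have e1 : (j : ℤ) - i = (p : ℕ) := by omega
    have e2 : 2 * (i : ℤ) - j = (q : ℕ) := by omega
    have e3 : (n : ℤ) + 1 - 2 * j + 2 * i = n + 1 - 2 * (p : ℕ) := by omega
    rw [e1, e2, e3]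
    cases p with
    | zero =>
      have e4 : (n : ℤ) + 1 - 2 * ((0 : ℕ) : ℤ) = ((n + 1 : ℕ) : ℤ) := by push_cast; ring
      rw [e4, intChoose_nat, intChoose_nat, intChoose_neg_left (((0 : ℕ) : ℤ) - 1) _ (by simp)]
      simp [cl]
    | succ p =>
      have e5 : ((p + 1 : ℕ) : ℤ) - 1 = (p : ℕ) := by push_cast; ring
      rw [e5, intChoose_nat, intChoose_nat, cl]
      split_ifs with h2
      · have e4 : (n : ℤ) + 1 - 2 * ((p + 1 : ℕ) : ℤ) = ((n + 1 - 2 * (p + 1) : ℕ) : ℤ) := by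
          omega
        rw [e4, intChoose_nat, intChoose_nat]
      · rw [intChoose_neg_left ((n : ℤ) + 1 - _) _ (by omega),
          intChoose_neg_left ((n : ℤ) + 1 - _) _ (by omega)]
        simp
  · rw [fr_zero _ _ _ h]
    by_cases h1 : i ≤ j
    · rw [intChoose_neg_right _ (2 * (i : ℤ) - j) (by omega),
        intChoose_neg_right _ (2 * (i : ℤ) - j) (by omega)]
      simp
    · rw [intChoose_neg_left ((j : ℤ) - i) _ (by omega),
        intChoose_neg_left ((j : ℤ) - i - 1) _ (by omega)]
      simp

/-! ### Blocks of a line hypergraph -/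

lemma exists_blocks [DecidableEq V] {n d α : ℕ} {E : ℕ → Finset V} (hn : 0 < n) (hd : d = 2 * α)
    (h : IsLineHypergraph n d α E) :
    ∃ B : ℕ → Finset V, (∀ i ≤ n, (B i).card = α) ∧
      (∀ i j, i < j → j ≤ n → Disjoint (B i) (B j)) ∧ ∀ i < n, E i = B i ∪ B (i + 1) := by
  have hfar : ∀ i j, i + 1 < j → j < n → Disjoint (E i) (E j) := by
    intro i j hij hj
    by_contra hc
    rw [Finset.not_disjoint_iff_nonempty_inter, h.inter_nonempty_iff i (by omega) j hj (by omega)]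
      at hc
    omega
  obtain ⟨S, hS1, hS2, hS3⟩ : ∃ S ⊆ E 0, S.card = α ∧ (1 < n → Disjoint S (E 1)) := by
    by_cases h1 : 1 < n
    · refine ⟨E 0 \ E 1, Finset.sdiff_subset, ?_, fun _ => Finset.sdiff_disjoint⟩
      have := Finset.card_sdiff_add_card_inter (E 0) (E 1)
      rw [h.inter_card 0 h1, h.card_eq 0 hn] at this
      omega
    · obtain ⟨S, hS, hc⟩ := Finset.exists_subset_card_eq (s := E 0) (n := α)
        (by rw [h.card_eq 0 hn]; omega)
      exact ⟨S, hS, hc, fun h2 => absurd h2 h1⟩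
  let B : ℕ → Finset V := fun i => Nat.rec S (fun i T => E i \ T) i
  have B0 : B 0 = S := rfl
  have Bs : ∀ i, B (i + 1) = E i \ B i := fun _ => rfl
  clear_value B
  have main : ∀ i < n, B i ⊆ E i ∧ (B i).card = α ∧ (i + 1 < n → Disjoint (B i) (E (i + 1))) := by
    intro i
    induction i with
    | zero => intro _; rw [B0]; exact ⟨hS1, hS2, hS3⟩
    | succ i ih =>
      intro hi
      obtain ⟨h1, h2, h3⟩ := ih (by omega)
      have hc : (B (i + 1)).card = α := by
        rw [Bs, Finset.card_sdiff_of_subset h1, h2, h.card_eq i (by omega)]; omega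
      have he : E i ∩ E (i + 1) = B (i + 1) := by
        apply Finset.eq_of_subset_of_card_le
        · rw [Bs]
          intro v hv
          rw [Finset.mem_inter] at hv
          rw [Finset.mem_sdiff]
          exact ⟨hv.1, fun hb => Finset.disjoint_left.mp (h3 hi) hb hv.2⟩
        · rw [hc, h.inter_card i hi]
      refine ⟨by rw [← he]; exact Finset.inter_subset_right, hc, fun hi2 => ?_⟩
      exact Finset.disjoint_of_subset_left (by rw [← he]; exact Finset.inter_subset_left)
        (hfar i (i + 2) (by omega) hi2)
  refine ⟨B, ?_, ?_, ?_⟩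
  · intro i hi
    cases i with
    | zero => exact (main 0 hn).2.1
    | succ i =>
      obtain ⟨h1, h2, h3⟩ := main i (by omega)
      rw [Bs, Finset.card_sdiff_of_subset h1, h2, h.card_eq i (by omega)]; omega
  · intro i j hij hj
    obtain ⟨h1, h2, h3⟩ := main i (by omega)
    obtain ⟨j, rfl⟩ : ∃ l, j = l + 1 := ⟨j - 1, by omega⟩
    have hsub : B (j + 1) ⊆ E j := by rw [Bs]; exact Finset.sdiff_subset
    rcases (by omega : j = i ∨ j = i + 1 ∨ i + 1 < j) with rfl | rfl | h4
    · rw [Bs]; exact Finset.disjoint_sdiff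
    · exact Finset.disjoint_of_subset_right hsub (h3 (by omega))
    · exact Finset.disjoint_of_subset_left h1
        (Finset.disjoint_of_subset_right hsub (hfar i j h4 (by omega)))
  · intro i hi
    rw [Bs, Finset.union_sdiff_of_subset (main i hi).1]

/-- Conversion of the given resolutions. -/
lemma exists_GRes [Fintype V] [DecidableEq V] {I : Ideal (MvPolynomial V k)}
    (F : MinimalGradedFreeResolution k V I) :
    ∃ G : GRes I, ∀ i j, Nat.card {x : G.B i // G.deg i x = j} = F.β i j := by
  have hj0 : ∀ b : Σ j : ℕ, Fin (F.β 0 j), b.1 = 0 := by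
    rintro ⟨j, t⟩
    by_contra hj
    have := F.β_zero j
    simp only at hj
    rw [if_neg hj] at this
    rw [this] at t
    exact t.elim0
  have h00 : F.β 0 0 = 1 := by rw [F.β_zero]; rfl
  let pt : Σ j : ℕ, Fin (F.β 0 j) := ⟨0, ⟨0, by omega⟩⟩
  have huniq : ∀ b, b = pt := by
    rintro ⟨j, t⟩
    obtain rfl : j = 0 := hj0 ⟨j, t⟩
    have : t = ⟨0, by omega⟩ := by
      apply Fin.ext
      have := t.2
      simp only
      omega
    rw [this]
  refine ⟨⟨fun i => Σ j : ℕ, Fin (F.β i j), fun _ b => b.1, F.d, pt, huniq, hj0, ?_, F.exact_succ,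
    F.minimal, ?_⟩, ?_⟩
  · intro x
    rw [← F.exact_zero, LinearMap.mem_ker]
    have hx : ∀ x : (Σ j : ℕ, Fin (F.β 0 j)) →₀ MvPolynomial V k,
        F.aug x = x pt • F.aug (single pt 1) := by
      intro x
      have : x = x pt • single pt 1 := by
        ext1 b; rw [huniq b]; simp
      conv_lhs => rw [this, map_smul]
    obtain ⟨w, hw⟩ := F.aug_surjective 1
    rw [hx] at hw ⊢
    constructor
    · intro h0
      rw [← Ideal.Quotient.eq_zero_iff_mem]
      have : x pt • (w pt • F.aug (single pt 1)) = 0 := by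
        rw [smul_comm, h0, smul_zero]
      rw [hw] at this
      rw [← this]
      change _ = Ideal.Quotient.mk I (x pt * 1)
      rw [mul_one]
    · intro h0
      obtain ⟨r, hr⟩ := Ideal.Quotient.mk_surjective (F.aug (single pt 1))
      rw [← hr]
      change Ideal.Quotient.mk I (x pt * r) = 0
      exact Ideal.Quotient.eq_zero_iff_mem.mpr (I.mul_mem_right _ h0)
  · rintro i ⟨j, t⟩ p
    exact F.graded i j t p
  · intro i j
    change Nat.card {x : Σ j : ℕ, Fin (F.β i j) // x.1 = j} = _
    rw [Nat.card_congr (Equiv.sigmaSubtype j)]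
    simp

end Helpers

/-- Let `L_n^{d,α}` be a line hypergraph with `d = 2α`.  Then all
nonzero graded Betti numbers of `R ⧸ I(L_n^{d,α})` occur in degrees that are multiples
of `α`, and for `2j ≥ i`:
`β_{i, jα} = C(j-i, 2i-j)·C(n+1-2j+2i, j-i) + C(j-i-1, 2i-j)·C(n+1-2j+2i, j-i-1)`. -/
theorem gradedBetti_line_deq2alpha (k V : Type) [Field k] [Fintype V] [DecidableEq V]
    (n d α : ℕ) (E : ℕ → Finset V)
    (hn : 0 < n) (hd : d = 2 * α)
    (hline : IsLineHypergraph n d α E)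
    (F : MinimalGradedFreeResolution k V (edgeIdeal k (fun l : Fin n => E l.val))) :
    (∀ i j, F.β i j ≠ 0 → α ∣ j) ∧
      (∀ i j : ℕ, i ≤ 2 * j →
        F.β i (j * α) =
          intChoose ((j : ℤ) - i) (2 * i - j) * intChoose ((n : ℤ) + 1 - 2 * j + 2 * i) ((j : ℤ) - i) +
            intChoose ((j : ℤ) - i - 1) (2 * i - j) *
              intChoose ((n : ℤ) + 1 - 2 * j + 2 * i) ((j : ℤ) - i - 1)) := by
  obtain ⟨G, hG⟩ := exists_GRes F
  have hα : 0 < α := by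
    rw [Nat.pos_iff_ne_zero]
    rintro rfl
    have hE : E 0 = ∅ := by
      rw [← Finset.card_eq_zero, hline.card_eq 0 hn, hd]
    have hmem : (1 : MvPolynomial V k) ∈ edgeIdeal k (fun l : Fin n => E l.val) := by
      refine Ideal.subset_span ⟨⟨0, hn⟩, ?_⟩
      simp [hE]
    obtain ⟨y, hy⟩ := (G.exact0 (Finsupp.single G.pt 1)).mpr (by simpa using hmem)
    have := G.minimal 0 y G.pt
    rw [hy] at this
    simp at this
  obtain ⟨B, hB1, hB2, hB3⟩ := exists_blocks hn hd hline
  have hI : edgeIdeal k (fun l : Fin n => E l.val) = IS k (PS B n) := by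
    unfold edgeIdeal IS
    congr 1
    ext f
    constructor
    · rintro ⟨l, rfl⟩
      exact ⟨E l.val, ⟨l.val, l.2, hB3 _ l.2⟩, rfl⟩
    · rintro ⟨T, ⟨l, hl, rfl⟩, rfl⟩
      refine ⟨⟨l, hl⟩, ?_⟩
      rw [← hB3 l hl]
      rfl
  have hH := path_hasBetti (k := k) hα hB1 hB2 n le_rfl
  rw [← hI] at hH
  obtain ⟨G0, _, hG0⟩ := hH
  have hβ : ∀ i j, F.β i j = scaleB α (pathB n) i j := fun i j => by
    rw [← hG, ← hG0, GRes.card_eq G G0]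
  refine ⟨fun i j h => ?_, fun i j _ => ?_⟩
  · by_contra hc
    exact h (by rw [hβ, scaleB, if_neg hc])
  · rw [hβ, scaleB, if_pos (Nat.dvd_mul_left α j), Nat.mul_div_cancel _ hα, pathB_eq, closed_form]
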